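/- Let (X, U, f) be a robot grid search problem. Then for all x_I, x_I' ∈ X there exists a finite action sequence ũ such that x_I⌢ũ = x_I'⌢ũ, i.e., applying the same sequence of actions from the two initial states leads to the same final state. -/

import Mathlib

/-- The four unit-length grid actions `left, right, up, down`. -/
def Ugrid : Set (ℤ × ℤ) := {(-1, 0), (1, 0), (0, 1), (0, -1)}

/-- A subset `Z ⊆ ℤ×ℤ` is a connected grid if any two of its points are joined by
a finite chain of points of `Z` in which consecutive points are at (Euclidean)
distance `1`, i.e. the coordinate differences have absolute values summing to `1`. -/
def ConnectedGrid (Z : Set (ℤ × ℤ)) : Prop :=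
  ∀ z1 ∈ Z, ∀ z2 ∈ Z, ∃ n : ℕ, ∃ x : Fin (n + 1) → ℤ × ℤ,
    (∀ k, x k ∈ Z) ∧ x 0 = z1 ∧ x (Fin.last n) = z2 ∧
    ∀ k : Fin n, ((x k.succ).1 - (x k.castSucc).1).natAbs
      + ((x k.succ).2 - (x k.castSucc).2).natAbs = 1

/-- The stay-put transition function: `f(x,u) = x + u` if `x + u ∈ X`, else `x`. -/
noncomputable def fstep (X : Set (ℤ × ℤ)) (x u : ℤ × ℤ) : ℤ × ℤ :=
  @ite _ (x + u ∈ X) (Classical.propDecidable _) (x + u) x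

theorem fstep_mem {X : Set (ℤ × ℤ)} {x : ℤ × ℤ} (hx : x ∈ X) (u : ℤ × ℤ) : fstep X x u ∈ X := by
  unfold fstep
  split_ifs with h
  · exact h
  · exact hx

theorem foldl_fstep_mem {X : Set (ℤ × ℤ)} (w : List (ℤ × ℤ)) {x : ℤ × ℤ} (hx : x ∈ X) :
    w.foldl (fstep X) x ∈ X := by
  induction w generalizing x with
  | nil => exact hx
  | cons u w ih => exact ih (fstep_mem hx u)

/-- A word either translates a point by its sum, or some action is blocked and can be deleted. -/
theorem foldl_fstep_eq_add_sum_or_shorter (X : Set (ℤ × ℤ)) (w : List (ℤ × ℤ)) (x : ℤ × ℤ) :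
    w.foldl (fstep X) x = x + w.sum ∨
      ∃ w' : List (ℤ × ℤ), w' ⊆ w ∧ w'.length < w.length ∧
        w'.foldl (fstep X) x = w.foldl (fstep X) x := by
  induction w generalizing x with
  | nil => simp
  | cons u w ih =>
    by_cases h : x + u ∈ X
    · have hs : fstep X x u = x + u := if_pos h
      rcases ih (x + u) with h1 | ⟨w', hsub, hlen, heq⟩
      · left
        rw [List.foldl_cons, hs, h1, List.sum_cons, add_assoc]
      · exact .inr ⟨u :: w', List.cons_subset_cons u hsub, by simpa using hlen,
          by simpa [hs] using heq⟩
    · have hs : fstep X x u = x := if_neg h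
      exact .inr ⟨w, List.subset_cons_self u w, by simp, by simp [hs]⟩

theorem exists_foldl_eq_iterate {α β : Type*} (g : α → β → α) (w : List β) (k : ℕ) :
    ∃ v : List β, v ⊆ w ∧ ∀ x, v.foldl g x = (fun y => w.foldl g y)^[k] x := by
  induction k with
  | zero => exact ⟨[], by simp, fun _ => rfl⟩
  | succ k ih =>
    obtain ⟨v, hv, h⟩ := ih
    refine ⟨v ++ w, List.append_subset.2 ⟨hv, List.Subset.refl w⟩, fun x => ?_⟩
    rw [List.foldl_append, h, Function.iterate_succ_apply']

/-- In a finite grid, a word all of whose iterates translate a point by its sum has sum zero. -/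
theorem sum_eq_zero_of_iterate_eq_add {X : Set (ℤ × ℤ)} (hfin : X.Finite) {a : ℤ × ℤ} (ha : a ∈ X)
    (w : List (ℤ × ℤ))
    (h : ∀ k : ℕ, w.foldl (fstep X) ((fun y => w.foldl (fstep X) y)^[k] a) =
      (fun y => w.foldl (fstep X) y)^[k] a + w.sum) :
    w.sum = 0 := by
  set F : ℤ × ℤ → ℤ × ℤ := fun y => w.foldl (fstep X) y with hF
  have hmem : ∀ k : ℕ, F^[k] a ∈ X := fun k => by
    induction k with
    | zero => exact ha
    | succ k ih =>
      rw [Function.iterate_succ_apply']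
      exact foldl_fstep_mem w ih
  have hlin : ∀ k : ℕ, F^[k] a = a + k • w.sum := fun k => by
    induction k with
    | zero => simp
    | succ k ih =>
      rw [Function.iterate_succ_apply']
      refine (h k).trans ?_
      rw [ih, succ_nsmul, add_assoc]
  obtain ⟨m, -, n, -, hmn, heq⟩ :=
    Set.infinite_univ.exists_ne_map_eq_of_mapsTo (f := fun k : ℕ => F^[k] a)
      (fun k _ => hmem k) hfin
  simp only [hlin, add_right_inj] at heq
  rw [Prod.ext_iff] at heq ⊢
  simpa [hmn] using heq

/-- Two states joined by an action word can be synchronized. -/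
theorem exists_sync_of_foldl_eq {X : Set (ℤ × ℤ)} (hfin : X.Finite) (w : List (ℤ × ℤ))
    (hw : ∀ u ∈ w, u ∈ Ugrid) {a : ℤ × ℤ} (ha : a ∈ X) :
    ∃ us : List (ℤ × ℤ), (∀ u ∈ us, u ∈ Ugrid) ∧
      us.foldl (fstep X) a = us.foldl (fstep X) (w.foldl (fstep X) a) := by
  induction hn : w.length using Nat.strong_induction_on generalizing w a with
  | _ n ih =>
    by_cases h : ∀ k : ℕ, w.foldl (fstep X) ((fun y => w.foldl (fstep X) y)^[k] a) =
      (fun y => w.foldl (fstep X) y)^[k] a + w.sum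
    · have h0 := h 0
      rw [sum_eq_zero_of_iterate_eq_add hfin ha w h, add_zero] at h0
      exact ⟨[], by simp, h0.symm⟩
    · obtain ⟨k, hk⟩ := not_forall.1 h
      obtain ⟨v, hv, hvk⟩ := exists_foldl_eq_iterate (fstep X) w k
      obtain ⟨w', hsub, hlen, heq⟩ :=
        (foldl_fstep_eq_add_sum_or_shorter X w _).resolve_left hk
      obtain ⟨us, hus, hsync⟩ := ih w'.length (hn ▸ hlen) w' (fun u hu => hw u (hsub hu))
        (foldl_fstep_mem v ha) rfl
      refine ⟨v ++ us, fun u hu => ?_, ?_⟩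
      · exact (List.mem_append.1 hu).elim (fun hu => hw u (hv hu)) (hus u)
      · rw [List.foldl_append, List.foldl_append, hsync, hvk, hvk, heq,
          ← Function.iterate_succ_apply, Function.iterate_succ_apply']

theorem sub_mem_Ugrid {x y : ℤ × ℤ} (h : (y.1 - x.1).natAbs + (y.2 - x.2).natAbs = 1) :
    y - x ∈ Ugrid := by
  simp only [Ugrid, Set.mem_insert_iff, Set.mem_singleton_iff, Prod.ext_iff, Prod.fst_sub,
    Prod.snd_sub]
  omega

/-- Any two states of a connected grid are joined by an action word. -/
theorem ConnectedGrid.exists_foldl_eq {X : Set (ℤ × ℤ)} (hconn : ConnectedGrid X) {a b : ℤ × ℤ}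
    (ha : a ∈ X) (hb : b ∈ X) :
    ∃ w : List (ℤ × ℤ), (∀ u ∈ w, u ∈ Ugrid) ∧ w.foldl (fstep X) a = b := by
  obtain ⟨n, x, hx, rfl, rfl, hstep⟩ := hconn a ha b hb
  suffices H : ∀ k : Fin (n + 1), ∃ w : List (ℤ × ℤ), (∀ u ∈ w, u ∈ Ugrid) ∧
      w.foldl (fstep X) (x 0) = x k from H _
  intro k
  induction k using Fin.induction with
  | zero => exact ⟨[], by simp, rfl⟩
  | succ k ih =>
    obtain ⟨w, hw, hwk⟩ := ih
    refine ⟨w ++ [x k.succ - x k.castSucc], fun u hu => ?_, ?_⟩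
    · rcases List.mem_append.1 hu with hu | hu
      · exact hw u hu
      · rw [List.mem_singleton.1 hu]
        exact sub_mem_Ugrid (hstep k)
    · simp [hwk, fstep, hx]

/-- **Robot grid search problems are pairwise synchronizing.** -/
theorem stmt4 (X : Set (ℤ × ℤ)) (hfin : X.Finite) (hne : X.Nonempty)
    (hconn : ConnectedGrid X) (xI xI' : ℤ × ℤ) (hxI : xI ∈ X) (hxI' : xI' ∈ X) :
    ∃ us : List (ℤ × ℤ), (∀ u ∈ us, u ∈ Ugrid) ∧
      us.foldl (fstep X) xI = us.foldl (fstep X) xI' := by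
  obtain ⟨w, hw, rfl⟩ := hconn.exists_foldl_eq hxI hxI'
  exact exists_sync_of_foldl_eq hfin w hw hxI
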